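/- arXiv:1809.10654 — 2 statements merged into one kernel-verified Lean document; each statement's English description precedes it below -/
import Mathlib

section
/- Fix 1 ≤ m ≤ n and 1 ≤ p < ∞. There exists a constant C > 0, depending only on Ω, m, n and p, such that for every φ ∈ C_c^∞(Ω) one has (Σ_{k=0}^{m} Σ_{α∈I_k} ‖D^α φ‖_{L^p}^p)^{1/p} ≤ C (Σ_{α∈I_m} ‖D^α φ‖_{L^p}^p)^{1/p}. (This is the inequality underlying the equivalence on M_0^{m,p}(Ω) of the seminorm ‖u; M_0^{m,p}‖ = (Σ_{α∈I_m} ‖D^α u‖_p^p)^{1/p} with the full norm ‖u; M^{m,p}‖.) -/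
open MeasureTheory Filter Set Topology
open scoped ENNReal

noncomputable section

/-- The open box `Ω = ∏ᵢ (aᵢ, bᵢ)` in `ℝⁿ`. -/
def boxΩ {n : ℕ} (a b : Fin n → ℝ) : Set (Fin n → ℝ) :=
  Set.univ.pi fun i => Set.Ioo (a i) (b i)

/-- A test function: infinitely differentiable with compact support contained in `Ω`. -/
def IsTest {n : ℕ} (Ω : Set (Fin n → ℝ)) (φ : (Fin n → ℝ) → ℝ) : Prop :=
  ContDiff ℝ (⊤ : ℕ∞) φ ∧ HasCompactSupport φ ∧ tsupport φ ⊆ Ω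

/-- The classical mixed partial derivative `D^α f` where the multi-index
`α ∈ {0,1}ⁿ` is encoded by the set `s` of coordinates with `αᵢ = 1`. -/
def mder {n : ℕ} (s : Finset (Fin n)) (f : (Fin n → ℝ) → ℝ) : (Fin n → ℝ) → ℝ :=
  (s.sort (· ≤ ·)).foldr (fun i g x => fderiv ℝ g x (Pi.single i 1)) f

/-- The `i`-th classical partial derivative of a function on `ℝⁿ`. -/
def partialDeriv {n : ℕ} (i : Fin n) (g : (Fin n → ℝ) → ℝ) : (Fin n → ℝ) → ℝ :=
  fun x => fderiv ℝ g x (Pi.single i 1)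

theorem mder_eq_foldr_partialDeriv {n : ℕ} (s : Finset (Fin n)) (f : (Fin n → ℝ) → ℝ) :
    mder s f = (s.sort (· ≤ ·)).foldr partialDeriv f := rfl

theorem ContDiff.contDiff_partialDeriv {n : ℕ} {f : (Fin n → ℝ) → ℝ} (hf : ContDiff ℝ (⊤ : ℕ∞) f)
    (i : Fin n) : ContDiff ℝ (⊤ : ℕ∞) (partialDeriv i f) :=
  (hf.fderiv_right (m := (⊤ : ℕ∞)) le_rfl).clm_apply contDiff_const

theorem ContDiff.contDiff_foldr_partialDeriv {n : ℕ} {f : (Fin n → ℝ) → ℝ}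
    (hf : ContDiff ℝ (⊤ : ℕ∞) f) (l : List (Fin n)) :
    ContDiff ℝ (⊤ : ℕ∞) (l.foldr partialDeriv f) := by
  induction l with
  | nil => exact hf
  | cons i l ih => exact ih.contDiff_partialDeriv i

theorem IsTest.isTest_partialDeriv {n : ℕ} {Ω : Set (Fin n → ℝ)} {f : (Fin n → ℝ) → ℝ}
    (hf : IsTest Ω f) (i : Fin n) : IsTest Ω (partialDeriv i f) := by
  obtain ⟨hsmooth, hcompact, hsupp⟩ := hf
  exact ⟨hsmooth.contDiff_partialDeriv i, hcompact.fderiv_apply ℝ _,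
    (tsupport_fderiv_apply_subset ℝ _).trans hsupp⟩

theorem IsTest.isTest_mder {n : ℕ} {Ω : Set (Fin n → ℝ)} {f : (Fin n → ℝ) → ℝ}
    (hf : IsTest Ω f) (s : Finset (Fin n)) : IsTest Ω (mder s f) := by
  rw [mder_eq_foldr_partialDeriv]
  induction s.sort (· ≤ ·) with
  | nil => exact hf
  | cons i l ih => exact ih.isTest_partialDeriv i

theorem partialDeriv_comm {n : ℕ} {f : (Fin n → ℝ) → ℝ} (hf : ContDiff ℝ (⊤ : ℕ∞) f)
    (i j : Fin n) :
    partialDeriv i (partialDeriv j f) = partialDeriv j (partialDeriv i f) := by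
  ext x
  have hd : DifferentiableAt ℝ (fderiv ℝ f) x :=
    ((hf.fderiv_right (m := (⊤ : ℕ∞)) le_rfl).differentiable (by simp)).differentiableAt
  have second (u v : Fin n → ℝ) :
      fderiv ℝ (fun y => fderiv ℝ f y v) x u = fderiv ℝ (fderiv ℝ f) x u v := by
    rw [fderiv_clm_apply hd (differentiableAt_const v)]
    simp
  have hsymm : IsSymmSndFDerivAt ℝ f x :=
    hf.contDiffAt.isSymmSndFDerivAt (by
      rw [minSmoothness_of_isRCLikeNormedField]
      exact WithTop.coe_le_coe.2 le_top)
  change fderiv ℝ (fun y => fderiv ℝ f y _) x _ = fderiv ℝ (fun y => fderiv ℝ f y _) x _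
  rw [second, second]
  exact hsymm _ _

theorem foldr_partialDeriv_perm {n : ℕ} {f : (Fin n → ℝ) → ℝ}
    (hf : ContDiff ℝ (⊤ : ℕ∞) f) {l l' : List (Fin n)} (h : l.Perm l') :
    l.foldr partialDeriv f = l'.foldr partialDeriv f := by
  induction h with
  | nil => rfl
  | cons i _ ih => simp only [List.foldr_cons, ih]
  | swap i j l => exact partialDeriv_comm (hf.contDiff_foldr_partialDeriv l) j i
  | trans _ _ ih₁ ih₂ => exact ih₁.trans ih₂

theorem mder_insert {n : ℕ} {f : (Fin n → ℝ) → ℝ} (hf : ContDiff ℝ (⊤ : ℕ∞) f)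
    {s : Finset (Fin n)} {i : Fin n} (hi : i ∉ s) :
    mder (insert i s) f = partialDeriv i (mder s f) := by
  simp only [mder_eq_foldr_partialDeriv]
  rw [← List.foldr_cons (f := partialDeriv)]
  refine foldr_partialDeriv_perm hf (Multiset.coe_eq_coe.1 ?_)
  rw [← Multiset.cons_coe, Finset.sort_eq, Finset.sort_eq, Finset.insert_val_of_notMem hi]

theorem IsTest.eq_zero {n : ℕ} {Ω : Set (Fin n → ℝ)} {f : (Fin n → ℝ) → ℝ}
    (hf : IsTest Ω f) {x : Fin n → ℝ} (hx : x ∉ Ω) : f x = 0 :=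
  image_eq_zero_of_notMem_tsupport fun h => hx (hf.2.2 h)

theorem IsTest.setIntegral_abs_rpow {n : ℕ} {Ω : Set (Fin n → ℝ)} {f : (Fin n → ℝ) → ℝ}
    (hf : IsTest Ω f) {p : ℝ} (hp : 0 < p) :
    ∫ x in Ω, |f x| ^ p = (∫⁻ x, ‖f x‖ₑ ^ p).toReal := by
  rw [setIntegral_eq_integral_of_forall_compl_eq_zero fun x hx => by
    simp [hf.eq_zero hx, hp.ne']]
  have hcont : Continuous fun x => |f x| ^ p :=
    hf.1.continuous.abs.rpow_const fun _ => Or.inr hp.le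
  rw [integral_eq_lintegral_of_nonneg_ae (Eventually.of_forall fun _ => by positivity)
    hcont.aestronglyMeasurable]
  congr 2 with x
  rw [← ENNReal.ofReal_rpow_of_nonneg (abs_nonneg _) hp.le, ← Real.norm_eq_abs,
    ofReal_norm]

theorem IsTest.lintegral_enorm_rpow_ne_top {n : ℕ} {Ω : Set (Fin n → ℝ)}
    {f : (Fin n → ℝ) → ℝ} (hf : IsTest Ω f) {p : ℝ} (hp : 0 < p) :
    ∫⁻ x, ‖f x‖ₑ ^ p ≠ ∞ := by
  have h := (hf.1.continuous.memLp_of_hasCompactSupport (p := ENNReal.ofReal p)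
    (μ := volume) hf.2.1).eLpNorm_lt_top
  have := (eLpNorm_lt_top_iff_lintegral_rpow_enorm_lt_top
    (by simpa using hp) ENNReal.ofReal_ne_top).1 h
  rw [ENNReal.toReal_ofReal hp.le] at this
  exact this.ne

theorem lintegral_rpow_le_measure_univ_mul {α : Type*} [MeasurableSpace α] (μ : Measure α)
    {f : α → ℝ} (hf : AEStronglyMeasurable f μ) {p : ℝ} (hp : 1 ≤ p) :
    (∫⁻ x, ‖f x‖ₑ ∂μ) ^ p ≤ μ univ ^ (p - 1) * ∫⁻ x, ‖f x‖ₑ ^ p ∂μ := by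
  have hp0 : 0 < p := by linarith
  have h := eLpNorm'_le_eLpNorm'_mul_rpow_measure_univ (μ := μ) zero_lt_one hp hf
  rw [eLpNorm'_eq_lintegral_enorm, eLpNorm'_eq_lintegral_enorm] at h
  simp only [ENNReal.rpow_one, div_one] at h
  calc (∫⁻ x, ‖f x‖ₑ ∂μ) ^ p
      ≤ ((∫⁻ x, ‖f x‖ₑ ^ p ∂μ) ^ (1 / p) * μ univ ^ (1 - 1 / p)) ^ p := by gcongr
    _ = μ univ ^ (p - 1) * ∫⁻ x, ‖f x‖ₑ ^ p ∂μ := by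
      rw [ENNReal.mul_rpow_of_nonneg _ _ hp0.le, ← ENNReal.rpow_mul, ← ENNReal.rpow_mul,
        one_div_mul_cancel hp0.ne', ENNReal.rpow_one, mul_comm]
      congr 2
      field_simp

/-- A test function on a box is controlled by the integral of its `i`-th partial derivative
over a segment whose length is the `i`-th side length. -/
theorem IsTest.enorm_le_lintegral_partialDeriv {n : ℕ} {a b : Fin n → ℝ}
    {f : (Fin n → ℝ) → ℝ} (hf : IsTest (boxΩ a b) f) (i : Fin n) (hab : a i < b i)
    (x : Fin n → ℝ) :
    ‖f x‖ₑ ≤ ∫⁻ t in Ioc 0 (b i - a i),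
      ‖partialDeriv i f (x - t • Pi.single i 1)‖ₑ := by
  by_cases hx : x ∈ boxΩ a b
  swap
  · simp [hf.eq_zero hx]
  have hend : f (x - (b i - a i) • Pi.single i 1) = 0 := hf.eq_zero fun h => by
    have h₁ := (h i trivial).1
    have h₂ := (hx i trivial).2
    simp at h₁
    linarith
  have hderiv (t : ℝ) : HasDerivAt (fun t : ℝ => f (x - t • Pi.single i 1))
      (-partialDeriv i f (x - t • Pi.single i 1)) t := by
    have hline : HasDerivAt (fun t : ℝ => x - t • (Pi.single i 1 : Fin n → ℝ))
        (-Pi.single i 1) t := by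
      simpa using ((hasDerivAt_id t).smul_const (Pi.single i 1 : Fin n → ℝ)).const_sub x
    have hF := (hf.1.differentiable (by simp) (x - t • Pi.single i 1)).hasFDerivAt
    have hcomp := hF.comp_hasDerivAt t hline
    rw [map_neg] at hcomp
    exact hcomp
  have hcont : Continuous fun t : ℝ => -partialDeriv i f (x - t • Pi.single i 1) :=
    ((hf.1.contDiff_partialDeriv i).continuous.comp (by fun_prop)).neg
  have hftc := intervalIntegral.integral_eq_sub_of_hasDerivAt (fun t _ => hderiv t)
    (hcont.intervalIntegrable 0 (b i - a i))
  rw [hend, intervalIntegral.integral_of_le (by linarith)] at hftc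
  calc ‖f x‖ₑ = ‖∫ t in Ioc 0 (b i - a i), -partialDeriv i f (x - t • Pi.single i 1)‖ₑ := by
        rw [hftc]; simp
    _ ≤ ∫⁻ t in Ioc 0 (b i - a i), ‖-partialDeriv i f (x - t • Pi.single i 1)‖ₑ :=
        enorm_integral_le_lintegral_enorm _
    _ = _ := by simp only [enorm_neg]

/-- The Poincaré inequality in the `i`-th coordinate direction. -/
theorem IsTest.setIntegral_le_partialDeriv {n : ℕ} {a b : Fin n → ℝ}
    {f : (Fin n → ℝ) → ℝ} (hf : IsTest (boxΩ a b) f) (i : Fin n) (hab : a i < b i)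
    {p : ℝ} (hp : 1 ≤ p) :
    ∫ x in boxΩ a b, |f x| ^ p ≤
      (b i - a i) ^ p * ∫ x in boxΩ a b, |partialDeriv i f x| ^ p := by
  have hp0 : 0 < p := by linarith
  set L := b i - a i
  have hL0 : 0 < L := sub_pos.2 hab
  have hg := hf.isTest_partialDeriv i
  set g := partialDeriv i f
  have hgcont := hg.1.continuous
  have hpt (x : Fin n → ℝ) : ‖f x‖ₑ ^ p ≤ ENNReal.ofReal L ^ (p - 1) *
      ∫⁻ t in Ioc 0 L, ‖g (x - t • Pi.single i 1)‖ₑ ^ p := by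
    refine (ENNReal.rpow_le_rpow (hf.enorm_le_lintegral_partialDeriv i hab x) hp0.le).trans ?_
    have hmeas : Continuous fun t : ℝ => g (x - t • Pi.single i 1) :=
      hgcont.comp (by fun_prop)
    simpa using lintegral_rpow_le_measure_univ_mul (volume.restrict (Ioc 0 L))
      hmeas.aestronglyMeasurable hp
  have hmeas : Measurable fun z : (Fin n → ℝ) × ℝ =>
      ‖g (z.1 - z.2 • Pi.single i 1)‖ₑ ^ p := by
    have : Continuous fun z : (Fin n → ℝ) × ℝ => g (z.1 - z.2 • Pi.single i 1) :=
      hgcont.comp (by fun_prop)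
    exact this.measurable.enorm.pow_const p
  have key : ∫⁻ x, ‖f x‖ₑ ^ p ≤ ENNReal.ofReal (L ^ p) * ∫⁻ x, ‖g x‖ₑ ^ p :=
    calc ∫⁻ x, ‖f x‖ₑ ^ p
        ≤ ∫⁻ x, ENNReal.ofReal L ^ (p - 1) *
            ∫⁻ t in Ioc 0 L, ‖g (x - t • Pi.single i 1)‖ₑ ^ p := lintegral_mono hpt
      _ = ENNReal.ofReal L ^ (p - 1) *
            ∫⁻ x, ∫⁻ t in Ioc 0 L, ‖g (x - t • Pi.single i 1)‖ₑ ^ p :=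
          lintegral_const_mul _ hmeas.lintegral_prod_right'
      _ = ENNReal.ofReal L ^ (p - 1) *
            ∫⁻ t in Ioc 0 L, ∫⁻ x, ‖g (x - t • Pi.single i 1)‖ₑ ^ p := by
          rw [lintegral_lintegral_swap hmeas.aemeasurable]
      _ = ENNReal.ofReal L ^ (p - 1) * ((∫⁻ x, ‖g x‖ₑ ^ p) * ENNReal.ofReal L) := by
          congr 1
          simp_rw [lintegral_sub_right_eq_self (fun x => ‖g x‖ₑ ^ p)]
          simp
      _ = ENNReal.ofReal (L ^ p) * ∫⁻ x, ‖g x‖ₑ ^ p := by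
          rw [mul_comm (∫⁻ x, ‖g x‖ₑ ^ p), ← mul_assoc,
            ENNReal.ofReal_rpow_of_pos hL0, ← ENNReal.ofReal_mul (by positivity),
            ← Real.rpow_add_one hL0.ne', sub_add_cancel]
  rw [hf.setIntegral_abs_rpow hp0, hg.setIntegral_abs_rpow hp0]
  have := ENNReal.toReal_mono
    (ENNReal.mul_ne_top ENNReal.ofReal_ne_top (hg.lintegral_enorm_rpow_ne_top hp0)) key
  rwa [ENNReal.toReal_mul, ENNReal.toReal_ofReal (by positivity)] at this

/-- Iterated Poincaré inequality: a mixed derivative of order `m - d` is controlled by the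
mixed derivatives of order `m`. -/
theorem IsTest.setIntegral_mder_le {n : ℕ} {a b : Fin n → ℝ} (hab : ∀ i, a i < b i)
    {φ : (Fin n → ℝ) → ℝ} (hφ : IsTest (boxΩ a b) φ) {p K : ℝ} (hp : 1 ≤ p) (hK₀ : 0 ≤ K)
    (hK : ∀ i, (b i - a i) ^ p ≤ K) {m : ℕ} (hmn : m ≤ n) (d : ℕ) (s : Finset (Fin n))
    (hs : s.card + d = m) :
    ∫ x in boxΩ a b, |mder s φ x| ^ p ≤
      K ^ d * ∑ t ∈ Finset.univ.filter (fun t : Finset (Fin n) => t.card = m),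
        ∫ x in boxΩ a b, |mder t φ x| ^ p := by
  have hnonneg (t : Finset (Fin n)) : 0 ≤ ∫ x in boxΩ a b, |mder t φ x| ^ p :=
    integral_nonneg fun _ => by positivity
  induction d generalizing s with
  | zero =>
    simpa using Finset.single_le_sum (f := fun t => ∫ x in boxΩ a b, |mder t φ x| ^ p)
      (fun t _ => hnonneg t) (by simpa using hs :
        s ∈ Finset.univ.filter (fun t : Finset (Fin n) => t.card = m))
  | succ d ih =>
    obtain ⟨i, hi⟩ : ∃ i, i ∉ s := by
      by_contra! h
      have : s.card = n := by simp [Finset.eq_univ_iff_forall.2 h]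
      omega
    have hcard : (insert i s).card + d = m := by
      rw [Finset.card_insert_of_notMem hi]; omega
    calc ∫ x in boxΩ a b, |mder s φ x| ^ p
        ≤ (b i - a i) ^ p * ∫ x in boxΩ a b, |mder (insert i s) φ x| ^ p := by
          rw [mder_insert hφ.1 hi]
          exact (hφ.isTest_mder s).setIntegral_le_partialDeriv i (hab i) hp
      _ ≤ K * (K ^ d * ∑ t ∈ Finset.univ.filter (fun t : Finset (Fin n) => t.card = m),
            ∫ x in boxΩ a b, |mder t φ x| ^ p) :=
          mul_le_mul (hK i) (ih _ hcard) (hnonneg _) hK₀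
      _ = _ := by ring

/-- Equivalence of the seminorm `‖·; M₀^{m,p}‖` with the full `M^{m,p}` norm on
test functions. -/
theorem statement3 {n : ℕ} (a b : Fin n → ℝ) (hab : ∀ i, a i < b i)
    (m : ℕ) (hm1 : 1 ≤ m) (hmn : m ≤ n) (p : ℝ) (hp : 1 ≤ p) :
    ∃ C > (0 : ℝ), ∀ φ : (Fin n → ℝ) → ℝ, IsTest (boxΩ a b) φ →
      (∑ s ∈ Finset.univ.filter (fun s : Finset (Fin n) => s.card ≤ m),
          ∫ x in boxΩ a b, |mder s φ x| ^ p) ^ (1 / p) ≤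
      C * (∑ s ∈ Finset.univ.filter (fun s : Finset (Fin n) => s.card = m),
          ∫ x in boxΩ a b, |mder s φ x| ^ p) ^ (1 / p) := by
  have hp0 : 0 < p := by linarith
  have hside (i : Fin n) : 0 ≤ (b i - a i) ^ p :=
    Real.rpow_nonneg (sub_nonneg.2 (hab i).le) p
  set K : ℝ := 1 + ∑ i, (b i - a i) ^ p
  have hK₁ : 1 ≤ K := le_add_of_nonneg_right (Finset.sum_nonneg fun i _ => hside i)
  have hK (i : Fin n) : (b i - a i) ^ p ≤ K :=
    (Finset.single_le_sum (fun i _ => hside i) (Finset.mem_univ i)).trans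
      (le_add_of_nonneg_left zero_le_one)
  have hN : 0 < (Finset.univ.filter fun s : Finset (Fin n) => s.card ≤ m).card :=
    Finset.card_pos.2 ⟨∅, by simp⟩
  set N := (Finset.univ.filter fun s : Finset (Fin n) => s.card ≤ m).card
  refine ⟨(N * K ^ m) ^ (1 / p), by positivity, fun φ hφ => ?_⟩
  have hnonneg (t : Finset (Fin n)) : 0 ≤ ∫ x in boxΩ a b, |mder t φ x| ^ p :=
    integral_nonneg fun _ => by positivity
  have hsum : 0 ≤ ∑ t ∈ Finset.univ.filter (fun t : Finset (Fin n) => t.card = m),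
      ∫ x in boxΩ a b, |mder t φ x| ^ p := Finset.sum_nonneg fun t _ => hnonneg t
  rw [← Real.mul_rpow (by positivity) hsum]
  refine Real.rpow_le_rpow (Finset.sum_nonneg fun t _ => hnonneg t) ?_ (by positivity)
  rw [mul_assoc, ← nsmul_eq_mul]
  refine Finset.sum_le_card_nsmul _ _ _ fun s hs => ?_
  have hs' : s.card ≤ m := (Finset.mem_filter.1 hs).2
  refine (hφ.setIntegral_mder_le hab hp (by linarith) hK hmn (m - s.card) s (by omega)).trans ?_
  exact mul_le_mul_of_nonneg_right (pow_le_pow_right₀ hK₁ (Nat.sub_le _ _)) hsum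

end
end

section
/- Let u ∈ Cⁿ(cl Ω) (u is n times continuously differentiable on the closure of Ω, all mixed partial derivatives of order ≤ n extending continuously to cl Ω) and suppose u = 0 on the boundary ∂Ω. Then (1) u(x) = (T (D^{(1,…,1)} u))(x) = ∫_{aₙ}^{xₙ} … ∫_{a₁}^{x₁} (∂ⁿu/∂x₁…∂xₙ)(ξ) dξ₁ … dξₙ for all x ∈ Ω, and (2) for every 1 ≤ i ≤ n, ∫_{a_i}^{b_i} (∂ⁿu/∂x₁…∂xₙ)(x₁,…,ξ_i,…,xₙ) dξ_i = 0 for all values of the remaining coordinates; i.e., D^{(1,…,1)} u ∈ L₀ (and hence u ∈ M_0^{n,2}(Ω)). -/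
open MeasureTheory Filter Set Topology
open scoped ENNReal

noncomputable section

/-- Lebesgue measure restricted to the box. -/
def boxμ {n : ℕ} (a b : Fin n → ℝ) : Measure (Fin n → ℝ) :=
  volume.restrict (boxΩ a b)

/-- `w` is the weak derivative `D^α u` on `Ω` (w.r.t. the measure `μ`),
where `α ∈ {0,1}ⁿ` is encoded by `s`. -/
def IsWeakDeriv {n : ℕ} (μ : Measure (Fin n → ℝ)) (Ω : Set (Fin n → ℝ))
    (s : Finset (Fin n)) (u w : (Fin n → ℝ) → ℝ) : Prop :=
  ∀ φ : (Fin n → ℝ) → ℝ, IsTest Ω φ →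
    ∫ x, u x * mder s φ x ∂μ = (-1 : ℝ) ^ s.card * ∫ x, w x * φ x ∂μ
/-- Integration of the `i`-th coordinate over its full range `(aᵢ, bᵢ)`. -/
def Sone {n : ℕ} (a b : Fin n → ℝ) (i : Fin n) (v : (Fin n → ℝ) → ℝ) :
    (Fin n → ℝ) → ℝ :=
  fun x => ∫ t in (a i)..(b i), v (Function.update x i t)

/-- The operator `S_α`: integration over all coordinates in `s`, each over its
full range; the multi-index `α ∈ {0,1}ⁿ` is encoded by the set `s` of
coordinates with `αᵢ = 1`. -/
def Sop {n : ℕ} (a b : Fin n → ℝ) (s : Finset (Fin n)) (v : (Fin n → ℝ) → ℝ) :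
    (Fin n → ℝ) → ℝ :=
  (s.sort (· ≤ ·)).foldr (Sone a b) v

/-- Membership in the subspace `L₀ = {v ∈ L²(Ω) : Sᵢ v = 0 a.e. for all i}`. -/
def MemL0 {n : ℕ} (μ : Measure (Fin n → ℝ)) (a b : Fin n → ℝ)
    (v : (Fin n → ℝ) → ℝ) : Prop :=
  ∀ i : Fin n, ∀ᵐ x ∂μ, Sone a b i v x = 0
/-- The Volterra-type operator `Tᵢ`: integration of the `i`-th coordinate from
`aᵢ` to `xᵢ`. -/
def Tone {n : ℕ} (a : Fin n → ℝ) (i : Fin n) (v : (Fin n → ℝ) → ℝ) :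
    (Fin n → ℝ) → ℝ :=
  fun x => ∫ t in (a i)..(x i), v (Function.update x i t)

/-- The operator `T_α = T_{i₁} ∘ … ∘ T_{i_k}` where `i₁ < … < i_k` are the
nonzero components of `α ∈ {0,1}ⁿ`, encoded by the set `s`. -/
def Tmul {n : ℕ} (a : Fin n → ℝ) (s : Finset (Fin n)) (v : (Fin n → ℝ) → ℝ) :
    (Fin n → ℝ) → ℝ :=
  (s.sort (· ≤ ·)).foldr (Tone a) v

/-- The closed box `∏ᵢ [aᵢ, bᵢ]`. -/
def closedBox {n : ℕ} (a b : Fin n → ℝ) : Set (Fin n → ℝ) :=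
  Set.univ.pi fun i => Set.Icc (a i) (b i)

/-- The `i`-th partial derivative within the closed box. -/
def partialWithin {n : ℕ} (a b : Fin n → ℝ) (i : Fin n) (g : (Fin n → ℝ) → ℝ) :
    (Fin n → ℝ) → ℝ :=
  fun x => fderivWithin ℝ g (closedBox a b) x (Pi.single i 1)

section BoxCalculus

variable {n : ℕ} {a b : Fin n → ℝ}

lemma closure_boxΩ (hab : ∀ i, a i < b i) : closure (boxΩ a b) = closedBox a b := by
  simp only [boxΩ, closedBox, closure_pi_set, closure_Ioo (hab _).ne]

lemma isOpen_boxΩ : IsOpen (boxΩ a b) :=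
  isOpen_set_pi finite_univ fun _ _ => isOpen_Ioo

lemma boxΩ_subset_closedBox : boxΩ a b ⊆ closedBox a b :=
  Set.pi_mono fun _ _ => Ioo_subset_Icc_self

lemma uniqueDiffOn_closedBox (hab : ∀ i, a i < b i) : UniqueDiffOn ℝ (closedBox a b) :=
  UniqueDiffOn.univ_pi fun i => uniqueDiffOn_Icc (hab i)

lemma closedBox_subset_closure_interior (hab : ∀ i, a i < b i) :
    closedBox a b ⊆ closure (interior (closedBox a b)) := by
  rw [← closure_boxΩ hab]
  exact closure_mono (interior_maximal subset_closure isOpen_boxΩ)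

lemma update_mem_closedBox {x : Fin n → ℝ} (hx : x ∈ closedBox a b) {i : Fin n} {t : ℝ}
    (ht : t ∈ Icc (a i) (b i)) : Function.update x i t ∈ closedBox a b :=
  (update_mem_pi_iff_of_mem hx).2 fun _ => ht

lemma update_mem_boxΩ {x : Fin n → ℝ} (hx : x ∈ boxΩ a b) {i : Fin n} {t : ℝ}
    (ht : t ∈ Ioo (a i) (b i)) : Function.update x i t ∈ boxΩ a b :=
  (update_mem_pi_iff_of_mem hx).2 fun _ => ht

lemma ContDiffOn.partialWithin (hab : ∀ i, a i < b i) {g : (Fin n → ℝ) → ℝ} {m : ℕ}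
    (hg : ContDiffOn ℝ (m + 1 : ℕ) g (closedBox a b)) (i : Fin n) :
    ContDiffOn ℝ m (partialWithin a b i g) (closedBox a b) :=
  (hg.fderivWithin (uniqueDiffOn_closedBox hab) (by norm_cast)).clm_apply contDiffOn_const

lemma partialWithin_congr {f g : (Fin n → ℝ) → ℝ} (h : EqOn f g (closedBox a b)) (i : Fin n) :
    EqOn (partialWithin a b i f) (partialWithin a b i g) (closedBox a b) := fun x hx => by
  simp only [partialWithin, fderivWithin_congr h (h hx)]

lemma partialWithin_comm (hab : ∀ i, a i < b i) {g : (Fin n → ℝ) → ℝ}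
    (hg : ContDiffOn ℝ 2 g (closedBox a b)) (i j : Fin n) :
    EqOn (partialWithin a b i (partialWithin a b j g))
      (partialWithin a b j (partialWithin a b i g)) (closedBox a b) := by
  intro x hx
  have hU := uniqueDiffOn_closedBox hab
  have hd : DifferentiableWithinAt ℝ (fderivWithin ℝ g (closedBox a b)) (closedBox a b) x :=
    (hg.fderivWithin hU (m := 1) (by norm_num)).differentiableOn (by norm_num) x hx
  have key : ∀ k l : Fin n, partialWithin a b k (partialWithin a b l g) x =
      fderivWithin ℝ (fderivWithin ℝ g (closedBox a b)) (closedBox a b) x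
        (Pi.single k 1) (Pi.single l 1) := fun k l => by
    change fderivWithin ℝ (fun y => fderivWithin ℝ g (closedBox a b) y (Pi.single l 1)) _ _ _ = _
    rw [fderivWithin_clm_apply (hU x hx) hd (differentiableWithinAt_const _)]
    simp
  rw [key, key]
  exact (hg x hx).isSymmSndFDerivWithinAt (by simp) hU
    (closedBox_subset_closure_interior hab hx) hx _ _

lemma hasDerivWithinAt_partialWithin {g : (Fin n → ℝ) → ℝ}
    (hg : ContDiffOn ℝ 1 g (closedBox a b)) {x : Fin n → ℝ} (hx : x ∈ closedBox a b)
    (i : Fin n) {t : ℝ} (ht : t ∈ Icc (a i) (b i)) :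
    HasDerivWithinAt (fun s => g (Function.update x i s))
      (partialWithin a b i g (Function.update x i t)) (Icc (a i) (b i)) t :=
  ((hg.differentiableOn (by norm_num) _
    (update_mem_closedBox hx ht)).hasFDerivWithinAt).comp_hasDerivWithinAt t
    (hasDerivAt_update x i t).hasDerivWithinAt fun _ hs => update_mem_closedBox hx hs

lemma partialWithin_eq_zero_of_face (hab : ∀ i, a i < b i) {g : (Fin n → ℝ) → ℝ}
    (hg : ContDiffOn ℝ 1 g (closedBox a b)) {i j : Fin n} (hij : i ≠ j) {c : ℝ}
    (h0 : ∀ x ∈ closedBox a b, x j = c → g x = 0) :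
    ∀ x ∈ closedBox a b, x j = c → partialWithin a b i g x = 0 := by
  intro x hx hxc
  have hxi := hx i (mem_univ i)
  have h := hasDerivWithinAt_partialWithin hg hx i hxi
  rw [Function.update_eq_self] at h
  have hz : HasDerivWithinAt (fun s => g (Function.update x i s)) 0 (Icc (a i) (b i)) (x i) :=
    (hasDerivWithinAt_const (x i) _ (0 : ℝ)).congr_of_mem
      (fun s hs => h0 _ (update_mem_closedBox hx hs)
        (by rw [Function.update_of_ne hij.symm, hxc])) hxi
  exact (uniqueDiffOn_Icc (hab i) _ hxi).eq_deriv _ h hz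

lemma integral_partialWithin (hab : ∀ i, a i < b i) {g : (Fin n → ℝ) → ℝ}
    (hg : ContDiffOn ℝ 1 g (closedBox a b)) {x : Fin n → ℝ} (hx : x ∈ closedBox a b)
    (i : Fin n) {t : ℝ} (ht : t ∈ Icc (a i) (b i)) :
    ∫ s in (a i)..t, partialWithin a b i g (Function.update x i s) =
      g (Function.update x i t) - g (Function.update x i (a i)) := by
  have hsub : Icc (a i) t ⊆ Icc (a i) (b i) := Icc_subset_Icc_right ht.2
  have hder : ∀ s ∈ Icc (a i) t, HasDerivWithinAt (fun s => g (Function.update x i s))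
      (partialWithin a b i g (Function.update x i s)) (Icc (a i) (b i)) s :=
    fun s hs => hasDerivWithinAt_partialWithin hg hx i (hsub hs)
  refine intervalIntegral.integral_eq_sub_of_hasDerivAt_of_le ht.1
    (fun s hs => ((hder s hs).mono hsub).continuousWithinAt)
    (fun s hs => (hder s (Ioo_subset_Icc_self hs)).hasDerivAt
      (Icc_mem_nhds hs.1 (hs.2.trans_le ht.2))) ?_
  apply ContinuousOn.intervalIntegrable
  rw [uIcc_of_le ht.1]
  exact (ContDiffOn.partialWithin (m := 0) hab (by simpa using hg) i).continuousOn.comp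
    (show Continuous (Function.update x i) from
      continuous_const.update i continuous_id).continuousOn
    fun s hs => update_mem_closedBox hx (hsub hs)

lemma contDiffOn_foldr_partialWithin (hab : ∀ i, a i < b i) {g : (Fin n → ℝ) → ℝ}
    (l : List (Fin n)) {m : ℕ} (hg : ContDiffOn ℝ (m + l.length : ℕ) g (closedBox a b)) :
    ContDiffOn ℝ m (l.foldr (partialWithin a b) g) (closedBox a b) := by
  induction l generalizing m with
  | nil => simpa using hg
  | cons i l ih =>
    refine ContDiffOn.partialWithin hab (ih ?_) i
    rwa [List.length_cons, ← add_assoc, add_right_comm] at hg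

lemma foldr_partialWithin_eq_zero_of_face (hab : ∀ i, a i < b i) {g : (Fin n → ℝ) → ℝ}
    {l : List (Fin n)} (hg : ContDiffOn ℝ l.length g (closedBox a b)) {j : Fin n} (hj : j ∉ l)
    {c : ℝ} (h0 : ∀ x ∈ closedBox a b, x j = c → g x = 0) :
    ∀ x ∈ closedBox a b, x j = c → l.foldr (partialWithin a b) g x = 0 := by
  induction l with
  | nil => exact h0
  | cons i l ih =>
    rw [List.mem_cons, not_or] at hj
    refine partialWithin_eq_zero_of_face hab ?_ (Ne.symm hj.1)
      (ih (hg.of_le (by simp)) hj.2)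
    have := contDiffOn_foldr_partialWithin (m := 1) hab l (by rwa [add_comm])
    simpa using this

lemma partialWithin_foldr (hab : ∀ i, a i < b i) {g : (Fin n → ℝ) → ℝ} (i : Fin n)
    (l : List (Fin n)) (hg : ContDiffOn ℝ (l.length + 1 : ℕ) g (closedBox a b)) :
    EqOn (partialWithin a b i (l.foldr (partialWithin a b) g))
      (l.foldr (partialWithin a b) (partialWithin a b i g)) (closedBox a b) := by
  induction l with
  | nil => exact fun _ _ => rfl
  | cons j l ih =>
    have h2 := contDiffOn_foldr_partialWithin (m := 2) hab l
      (by rwa [List.length_cons, add_assoc, add_comm] at hg)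
    exact (partialWithin_comm hab (by simpa using h2) i j).trans
      (partialWithin_congr (ih (hg.of_le (by norm_cast; simp))) j)

lemma foldr_fderiv_eqOn_foldr_partialWithin (g : (Fin n → ℝ) → ℝ) (l : List (Fin n)) :
    EqOn (l.foldr (fun i g x => fderiv ℝ g x (Pi.single i 1)) g)
      (l.foldr (partialWithin a b) g) (boxΩ a b) := by
  induction l with
  | nil => exact fun _ _ => rfl
  | cons i l ih =>
    intro x hx
    have hn := isOpen_boxΩ.mem_nhds hx
    simp only [List.foldr_cons, partialWithin]
    rw [(ih.eventuallyEq_of_mem hn).fderiv_eq,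
      fderivWithin_of_mem_nhds (mem_of_superset hn boxΩ_subset_closedBox)]

lemma Tone_congr {f g : (Fin n → ℝ) → ℝ} (h : EqOn f g (boxΩ a b)) (i : Fin n) :
    EqOn (Tone a i f) (Tone a i g) (boxΩ a b) := fun x hx => by
  have hxi := hx i (mem_univ i)
  refine intervalIntegral.integral_congr_ae (Eventually.of_forall fun t ht => ?_)
  rw [uIoc_of_le hxi.1.le] at ht
  exact h (update_mem_boxΩ hx ⟨ht.1, ht.2.trans_lt hxi.2⟩)

lemma foldr_Tone_congr {f g : (Fin n → ℝ) → ℝ} (h : EqOn f g (boxΩ a b)) (l : List (Fin n)) :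
    EqOn (l.foldr (Tone a) f) (l.foldr (Tone a) g) (boxΩ a b) := by
  induction l with
  | nil => exact h
  | cons i l ih => exact Tone_congr ih i

lemma Sone_congr (hab : ∀ i, a i < b i) {f g : (Fin n → ℝ) → ℝ} (h : EqOn f g (boxΩ a b))
    (i : Fin n) : EqOn (Sone a b i f) (Sone a b i g) (boxΩ a b) := fun x hx => by
  simp only [Sone, intervalIntegral.integral_of_le (hab i).le, integral_Ioc_eq_integral_Ioo]
  exact setIntegral_congr_fun measurableSet_Ioo fun t ht => h (update_mem_boxΩ hx ht)

lemma foldr_Tone_foldr_partialWithin (hab : ∀ i, a i < b i) {l : List (Fin n)} (hl : l.Nodup)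
    {g : (Fin n → ℝ) → ℝ} (hg : ContDiffOn ℝ l.length g (closedBox a b))
    (h0 : ∀ j ∈ l, ∀ x ∈ closedBox a b, x j = a j → g x = 0) :
    EqOn (l.foldr (Tone a) (l.foldr (partialWithin a b) g)) g (boxΩ a b) := by
  induction l generalizing g with
  | nil => exact fun _ _ => rfl
  | cons i l ih =>
    rw [List.nodup_cons] at hl
    have hg1 : ContDiffOn ℝ 1 g (closedBox a b) := hg.of_le (by simp)
    have hrec : EqOn (l.foldr (Tone a) ((i :: l).foldr (partialWithin a b) g))
        (partialWithin a b i g) (boxΩ a b) :=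
      (foldr_Tone_congr ((partialWithin_foldr hab i l hg).mono boxΩ_subset_closedBox) l).trans
        (ih hl.2 (ContDiffOn.partialWithin hab hg i) fun j hj =>
          partialWithin_eq_zero_of_face hab hg1 (ne_of_mem_of_not_mem hj hl.1).symm
            (h0 j (List.mem_cons_of_mem _ hj)))
    refine (Tone_congr hrec i).trans fun x hx => ?_
    have hxK := boxΩ_subset_closedBox hx
    rw [Tone, integral_partialWithin hab hg1 hxK i (hxK i (mem_univ i)),
      Function.update_eq_self, h0 i List.mem_cons_self _
        (update_mem_closedBox hxK (left_mem_Icc.2 (hab i).le)) (Function.update_self ..), sub_zero]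

lemma Sone_foldr_partialWithin (hab : ∀ i, a i < b i) {l : List (Fin n)} (hl : l.Nodup)
    {g : (Fin n → ℝ) → ℝ} (hg : ContDiffOn ℝ l.length g (closedBox a b)) {i : Fin n}
    (hi : i ∈ l) (ha : ∀ x ∈ closedBox a b, x i = a i → g x = 0)
    (hb : ∀ x ∈ closedBox a b, x i = b i → g x = 0) {x : Fin n → ℝ} (hx : x ∈ boxΩ a b) :
    Sone a b i (l.foldr (partialWithin a b) g) x = 0 := by
  obtain ⟨s, t, rfl⟩ := List.append_of_mem hi
  have hlen : (s ++ i :: t).length = (s ++ t).length + 1 := by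
    simp only [List.length_append, List.length_cons]; omega
  rw [hlen] at hg
  have hnot : i ∉ s ++ t := (List.nodup_middle.1 hl |> List.nodup_cons.1).1
  have hG : ContDiffOn ℝ 1 ((s ++ t).foldr (partialWithin a b) g) (closedBox a b) := by
    simpa using contDiffOn_foldr_partialWithin (m := 1) hab (s ++ t) (by rwa [add_comm])
  have hg' : ContDiffOn ℝ (s ++ t).length g (closedBox a b) := hg.of_le (by norm_cast; simp)
  have hcomm : EqOn ((s ++ i :: t).foldr (partialWithin a b) g)
      (partialWithin a b i ((s ++ t).foldr (partialWithin a b) g)) (closedBox a b) := by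
    rw [List.foldr_append, List.foldr_append, List.foldr_cons]
    refine (partialWithin_foldr hab i s (contDiffOn_foldr_partialWithin hab t ?_)).symm
    rwa [List.length_append, add_right_comm] at hg
  have hxK := boxΩ_subset_closedBox hx
  rw [Sone_congr hab (hcomm.mono boxΩ_subset_closedBox) i hx, Sone,
    integral_partialWithin hab hG hxK i (right_mem_Icc.2 (hab i).le),
    foldr_partialWithin_eq_zero_of_face hab hg' hnot ha _
      (update_mem_closedBox hxK (left_mem_Icc.2 (hab i).le)) (Function.update_self ..),
    foldr_partialWithin_eq_zero_of_face hab hg' hnot hb _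
      (update_mem_closedBox hxK (right_mem_Icc.2 (hab i).le)) (Function.update_self ..), sub_zero]

end BoxCalculus

/-- If `u ∈ Cⁿ(cl Ω)` vanishes on the boundary `∂Ω`, then
`u = T(D^{(1,…,1)}u)` on `Ω` and the mixed derivative `D^{(1,…,1)}u`
integrates to zero over each coordinate's full range, i.e.
`D^{(1,…,1)}u ∈ L₀`. -/
theorem statement13 {n : ℕ} (a b : Fin n → ℝ) (hab : ∀ i, a i < b i)
    (u : (Fin n → ℝ) → ℝ)
    (hu : ContDiffOn ℝ n u (closure (boxΩ a b)))
    (hbd : ∀ x ∈ frontier (boxΩ a b), u x = 0) :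
    (∀ x ∈ boxΩ a b, u x = Tmul a Finset.univ (mder Finset.univ u) x) ∧
    (∀ i : Fin n, ∀ x ∈ boxΩ a b, Sone a b i (mder Finset.univ u) x = 0) ∧
    MemL0 (boxμ a b) a b (mder Finset.univ u) := by
  have hfr : ∀ i, ∀ x ∈ closedBox a b, x i ∉ Ioo (a i) (b i) → u x = 0 := fun i x hx hxi => by
    apply hbd
    rw [isOpen_boxΩ.frontier_eq, closure_boxΩ hab]
    exact ⟨hx, fun h => hxi (h i (mem_univ i))⟩
  have ha : ∀ i, ∀ x ∈ closedBox a b, x i = a i → u x = 0 := fun i x hx h =>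
    hfr i x hx (by simp [h])
  have hb : ∀ i, ∀ x ∈ closedBox a b, x i = b i → u x = 0 := fun i x hx h =>
    hfr i x hx (by simp [h])
  have hnd : (Finset.univ.sort (· ≤ ·) : List (Fin n)).Nodup := Finset.sort_nodup ..
  rw [closure_boxΩ hab] at hu
  replace hu : ContDiffOn ℝ (Finset.univ.sort (· ≤ ·) : List (Fin n)).length u
      (closedBox a b) := by simpa using hu
  have hD : EqOn (mder Finset.univ u) ((Finset.univ.sort (· ≤ ·)).foldr (partialWithin a b) u)
      (boxΩ a b) := foldr_fderiv_eqOn_foldr_partialWithin u _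
  have hS : ∀ i : Fin n, ∀ x ∈ boxΩ a b, Sone a b i (mder Finset.univ u) x = 0 :=
    fun i x hx => by
      rw [Sone_congr hab hD i hx]
      exact Sone_foldr_partialWithin hab hnd hu (by simp) (ha i) (hb i) hx
  refine ⟨fun x hx => ?_, hS, fun i => ?_⟩
  · exact ((foldr_Tone_congr hD _ hx).trans
      (foldr_Tone_foldr_partialWithin hab hnd hu (fun j _ => ha j) hx)).symm
  · exact (ae_restrict_iff' isOpen_boxΩ.measurableSet).2 (Eventually.of_forall (hS i))

end
end
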